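/- Let φ : ℝ → ℂ be a Schwartz function whose Fourier transform is supported in [−1,1], and let (hₙ)_{n≥1} ⊂ (0,∞), (ξₙ)_{n≥1} ⊂ ℝ, (xₙ)_{n≥1} ⊂ ℝ, (tₙ)_{n≥1} ⊂ ℝ be sequences with |hₙξₙ| → ∞ as n → ∞. Then, with gₙ = g_{0,xₙ,hₙ}, lim_{n→∞} ‖ D^{1/6} e^{-(t−tₙ)∂ₓ³} gₙ[e^{i(·)hₙξₙ} φ] ‖_{L⁶_{t,x}(ℝ×ℝ)} = 3^{-1/6} ‖ e^{-it∂ₓ²} φ ‖_{L⁶_{t,x}(ℝ×ℝ)}. -/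

import Mathlib

open MeasureTheory Filter Topology Complex

noncomputable section

/-- The Fourier transform `f̂(ξ) = ∫ e^{-i x ξ} f(x) dx`. -/
def FT (f : ℝ → ℂ) (ξ : ℝ) : ℂ := ∫ x : ℝ, Complex.exp (-(Complex.I * x * ξ)) * f x

/-- The Airy evolution `e^{-t∂ₓ³} f (x) = ∫ e^{i(xξ + tξ³)} f̂(ξ) dξ`. -/
def airy (t : ℝ) (f : ℝ → ℂ) (x : ℝ) : ℂ :=
  ∫ ξ : ℝ, Complex.exp (Complex.I * (x * ξ + t * ξ ^ 3)) * FT f ξ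

/-- `D^{1/6} e^{-(t-t₀)∂ₓ³} f`, viewed as a function of `(t, x) ∈ ℝ × ℝ`. -/
def airyD6shift (t₀ : ℝ) (f : ℝ → ℂ) (p : ℝ × ℝ) : ℂ :=
  ∫ ξ : ℝ, Complex.exp (Complex.I * (p.2 * ξ + (p.1 - t₀) * ξ ^ 3)) *
    ((|ξ| ^ ((1 : ℝ)/6) : ℝ) : ℂ) * FT f ξ

/-- `D^{1/6} e^{-t∂ₓ³} f`, viewed as a function of `(t, x) ∈ ℝ × ℝ`. -/
def airyD6 (f : ℝ → ℂ) : ℝ × ℝ → ℂ := airyD6shift 0 f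

/-- The Schrödinger evolution `e^{-it∂ₓ²} f`, viewed as a function of `(t,x) ∈ ℝ × ℝ`. -/
def schrod (f : ℝ → ℂ) (p : ℝ × ℝ) : ℂ :=
  ∫ ξ : ℝ, Complex.exp (Complex.I * (p.2 * ξ + p.1 * ξ ^ 2)) * FT f ξ

/-- The transformation `g_{θ,x₀,h₀} f (x) = h₀^{-1/2} e^{iθ} f((x-x₀)/h₀)` with `θ = 0`. -/
def gT (x₀ h₀ : ℝ) (f : ℝ → ℂ) (x : ℝ) : ℂ :=
  ((h₀ ^ (-(1 : ℝ)/2) : ℝ) : ℂ) * f ((x - x₀) / h₀)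

/-- Modulation `e^{i(·)a} φ`. -/
def modF (a : ℝ) (φ : ℝ → ℂ) (x : ℝ) : ℂ := Complex.exp (Complex.I * x * a) * φ x

/-- Orthogonality of two sequences of parameters `(h, ξ, x, t) ∈ (0,∞) × ℝ³`. -/
def OrthoSeq (Γj Γk : ℕ → ℝ × ℝ × ℝ × ℝ) : Prop :=
  Tendsto (fun n => (Γj n).1 / (Γk n).1 + (Γk n).1 / (Γj n).1
      + (Γj n).1 * |(Γj n).2.1 - (Γk n).2.1|) atTop atTop
  ∨ ((∀ n, (Γj n).1 = (Γk n).1 ∧ (Γj n).2.1 = (Γk n).2.1) ∧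
     Tendsto (fun n =>
       |(Γk n).2.2.2 - (Γj n).2.2.2| / (Γj n).1 ^ 3
       + 3 * |((Γk n).2.2.2 - (Γj n).2.2.2) * (Γj n).2.1| / (Γj n).1 ^ 2
       + |(Γj n).2.2.1 - (Γk n).2.2.1
           + 3 * ((Γj n).2.2.2 - (Γk n).2.2.2) * (Γj n).2.1 ^ 2| / (Γj n).1)
       atTop atTop)

end

noncomputable section


/-- phase derivative -/
def pd (t x ε ζ : ℝ) : ℝ := x + 2 * t * ζ + ε * t * ζ ^ 2

def pdd (t ε ζ : ℝ) : ℝ := 2 * t + 2 * ε * t * ζ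

def ph (t x ε ζ : ℝ) : ℝ := x * ζ + t * ζ ^ 2 + ε / 3 * t * ζ ^ 3

lemma hasDeriv_ph (t x ε ζ : ℝ) : HasDerivAt (ph t x ε) (pd t x ε ζ) ζ := by
  unfold ph pd
  have h1 := (((hasDerivAt_id ζ).const_mul x).add (((hasDerivAt_id ζ).pow 2).const_mul t)).add
    (((hasDerivAt_id ζ).pow 3).const_mul (ε / 3 * t))
  refine HasDerivAt.congr_deriv h1 ?_
  simp
  ring

lemma hasDeriv_pd (t x ε ζ : ℝ) : HasDerivAt (pd t x ε) (pdd t ε ζ) ζ := by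
  unfold pd pdd
  have h1 := (((hasDerivAt_id ζ).const_mul (2 * t)).const_add x).add
    (((hasDerivAt_id ζ).pow 2).const_mul (ε * t))
  refine HasDerivAt.congr_deriv h1 ?_
  simp
  ring

lemma cont_ph (t x ε : ℝ) : Continuous (ph t x ε) := by unfold ph; fun_prop
lemma cont_pd (t x ε : ℝ) : Continuous (pd t x ε) := by unfold pd; fun_prop
lemma cont_pdd (t ε : ℝ) : Continuous (pdd t ε) := by unfold pdd; fun_prop

lemma eps_mul_bound {ε ζ : ℝ} (hε : |ε| ≤ 1/2) (hζ : ζ ∈ Set.Icc (-1:ℝ) 1) : |ε * ζ| ≤ 1/2 := by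
  rw [abs_mul]
  have : |ζ| ≤ 1 := abs_le.2 hζ
  nlinarith [abs_nonneg ε, abs_nonneg ζ]

lemma pdd_upper {t ε ζ : ℝ} (hε : |ε| ≤ 1/2) (hζ : ζ ∈ Set.Icc (-1:ℝ) 1) :
    |pdd t ε ζ| ≤ 3 * |t| := by
  have h := abs_le.1 (eps_mul_bound hε hζ)
  have : pdd t ε ζ = t * (2 + 2 * (ε * ζ)) := by unfold pdd; ring
  rw [this, abs_mul, mul_comm, abs_of_nonneg (by linarith : (0:ℝ) ≤ 2 + 2 * (ε * ζ))]
  gcongr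
  linarith

lemma Jbound {s t x ε : ℝ} (hs : 0 < s) (hN : s ^ 2 = max |t| |x|) (hε : |ε| ≤ 1/2) :
    ∫ ζ in (-1:ℝ)..1, s ^ 2 / (s ^ 2 + pd t x ε ζ ^ 2) ≤ 16 / s := by
  have hden : ∀ ζ, 0 < s ^ 2 + pd t x ε ζ ^ 2 := fun ζ => by positivity
  have hc : Continuous (fun ζ => s ^ 2 / (s ^ 2 + pd t x ε ζ ^ 2)) := by
    have := cont_pd t x ε
    exact continuous_const.div (by fun_prop) (fun ζ => (hden ζ).ne')
  rcases le_or_gt (4 * |t|) |x| with hx | hx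
  · have hsx : s ^ 2 = |x| := by
      rw [hN]; apply max_eq_right; linarith [abs_nonneg t]
    have hb : ∀ ζ ∈ Set.Icc (-1:ℝ) 1, s ^ 2 / (s ^ 2 + pd t x ε ζ ^ 2) ≤ 8 / s := by
      intro ζ hζ
      have h1 : |2 * t * ζ + ε * t * ζ ^ 2| ≤ 5/2 * |t| := by
        have : 2 * t * ζ + ε * t * ζ ^ 2 = t * (ζ * (2 + ε * ζ)) := by ring
        rw [this, abs_mul, mul_comm, abs_mul]
        have h := abs_le.1 (eps_mul_bound hε hζ)
        rw [abs_of_nonneg (by linarith : (0:ℝ) ≤ 2 + ε * ζ)]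
        have : |ζ| ≤ 1 := abs_le.2 hζ
        gcongr
        nlinarith [abs_nonneg ζ]
      have h2 : 3/8 * s ^ 2 ≤ |pd t x ε ζ| := by
        have h3 : x = pd t x ε ζ - (2 * t * ζ + ε * t * ζ ^ 2) := by unfold pd; ring
        have h4 : |x| ≤ |pd t x ε ζ| + |2 * t * ζ + ε * t * ζ ^ 2| := by
          conv_lhs => rw [h3]
          exact abs_sub _ _
        rw [hsx]; linarith
      rw [div_le_div_iff₀ (hden ζ) hs, ← sq_abs (pd t x ε ζ)]
      nlinarith [sq_nonneg (s - |pd t x ε ζ|), mul_le_mul_of_nonneg_left h2 hs.le]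
    calc _ ≤ ∫ ζ in (-1:ℝ)..1, 8 / s := by
          apply intervalIntegral.integral_mono_on (by norm_num) (hc.intervalIntegrable _ _)
            (by simp) hb
      _ = _ := by simp; ring
  · have hts : s ^ 2 ≤ 4 * |t| := by
      rw [hN]; apply max_le <;> linarith [abs_nonneg t]
    have ht : 0 < |t| := by nlinarith
    obtain ⟨σ, hσ, hσt⟩ : ∃ σ : ℝ, |σ| = 1 ∧ σ * t = |t| := by
      rcases abs_cases t with h | h
      · exact ⟨1, by simp, by linarith [h.1]⟩
      · exact ⟨-1, by simp, by linarith [h.1]⟩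
    have hd : ∀ ζ, HasDerivAt (fun ζ => 4 * σ / s * Real.arctan (pd t x ε ζ / s))
        (4 * σ * pdd t ε ζ / (s ^ 2 + pd t x ε ζ ^ 2)) ζ := by
      intro ζ
      have := (((hasDeriv_pd t x ε ζ).div_const s).arctan).const_mul (4 * σ / s)
      refine this.congr_deriv ?_
      have := (hden ζ).ne'
      have h2 : 1 + (pd t x ε ζ / s) ^ 2 ≠ 0 := by positivity
      field_simp
    have hc2 : Continuous (fun ζ => 4 * σ * pdd t ε ζ / (s ^ 2 + pd t x ε ζ ^ 2)) := by
      have := cont_pd t x ε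
      have := cont_pdd t ε
      exact Continuous.div (by fun_prop) (by fun_prop) (fun ζ => (hden ζ).ne')
    have hI := intervalIntegral.integral_eq_sub_of_hasDerivAt (a := -1) (b := 1)
      (fun ζ _ => hd ζ) (hc2.intervalIntegrable _ _)
    calc _ ≤ ∫ ζ in (-1:ℝ)..1, 4 * σ * pdd t ε ζ / (s ^ 2 + pd t x ε ζ ^ 2) := by
          apply intervalIntegral.integral_mono_on (by norm_num) (hc.intervalIntegrable _ _)
            (hc2.intervalIntegrable _ _)
          intro ζ hζ
          have := (hden ζ).le
          gcongr
          have h := abs_le.1 (eps_mul_bound hε hζ)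
          have : 4 * σ * pdd t ε ζ = 4 * |t| * (2 + 2 * (ε * ζ)) := by
            rw [← hσt]; unfold pdd; ring
          rw [this]
          nlinarith
      _ = _ := hI
      _ = 4 / s * (σ * (Real.arctan (pd t x ε 1 / s) - Real.arctan (pd t x ε (-1) / s))) := by ring
      _ ≤ 4 / s * 4 := by
          gcongr
          refine (le_abs_self _).trans ?_
          rw [abs_mul, hσ, one_mul, abs_le]
          have := Real.pi_lt_four
          constructor <;> linarith [Real.arctan_lt_pi_div_two (pd t x ε 1 / s), Real.neg_pi_div_two_lt_arctan (pd t x ε 1 / s), Real.arctan_lt_pi_div_two (pd t x ε (-1) / s), Real.neg_pi_div_two_lt_arctan (pd t x ε (-1) / s)]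
      _ = 16 / s := by ring

lemma osc {s t x ε M : ℝ} (hs : 0 < s) (hN : s ^ 2 = max |t| |x|) (hε : |ε| ≤ 1/2)
    (ψ ψ' : ℝ → ℂ) (hψ : ∀ ζ ∈ Set.Icc (-1:ℝ) 1, HasDerivAt ψ (ψ' ζ) ζ)
    (hc' : ContinuousOn ψ' (Set.Icc (-1) 1))
    (hM : ∀ ζ ∈ Set.Icc (-1:ℝ) 1, ‖ψ ζ‖ ≤ M) (hM' : ∀ ζ ∈ Set.Icc (-1:ℝ) 1, ‖ψ' ζ‖ ≤ M) :
    ‖∫ ζ in (-1:ℝ)..1, Complex.exp (Complex.I * (ph t x ε ζ : ℝ)) * ψ ζ‖ ≤ 68 * M / s := by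
  have hM0 : 0 ≤ M := (norm_nonneg _).trans (hM 0 (by simp))
  have hden : ∀ ζ, 0 < s ^ 2 + pd t x ε ζ ^ 2 := fun ζ => by positivity
  have huIcc : Set.uIcc (-1:ℝ) 1 = Set.Icc (-1) 1 := Set.uIcc_of_le (by norm_num)
  have cp := cont_ph t x ε
  have cpd := cont_pd t x ε
  have cpdd := cont_pdd t ε
  set J : ℝ → ℝ := fun ζ => s ^ 2 / (s ^ 2 + pd t x ε ζ ^ 2) with hJ
  have hJ0 : ∀ ζ, 0 ≤ J ζ := fun ζ => by simp only [hJ]; positivity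
  have hJc : Continuous J := continuous_const.div (by fun_prop) (fun ζ => (hden ζ).ne')
  set v : ℝ → ℝ := fun ζ => pd t x ε ζ / (s ^ 2 + pd t x ε ζ ^ 2) with hv
  have hvc : Continuous v := cpd.div (by fun_prop) (fun ζ => (hden ζ).ne')
  set v' : ℝ → ℝ := fun ζ => pdd t ε ζ * (s ^ 2 - pd t x ε ζ ^ 2) / (s ^ 2 + pd t x ε ζ ^ 2) ^ 2 with hv'
  have hvc' : Continuous v' := Continuous.div (by fun_prop) (by fun_prop) (fun ζ => (pow_pos (hden ζ) 2).ne')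
  have hvd : ∀ ζ, HasDerivAt v (v' ζ) ζ := by
    intro ζ
    have h1 := hasDeriv_pd t x ε ζ
    have := h1.div ((h1.pow 2).const_add (s ^ 2)) (hden ζ).ne'
    refine HasDerivAt.congr_deriv this ?_
    simp only [hv']
    congr 1
    simp
    ring
  have hvb : ∀ ζ, |v ζ| ≤ 1 / s := by
    intro ζ
    simp only [hv]
    rw [abs_div, abs_of_pos (hden ζ), div_le_div_iff₀ (hden ζ) hs, ← sq_abs (pd t x ε ζ)]
    nlinarith [sq_nonneg (s - |pd t x ε ζ|), abs_nonneg (pd t x ε ζ)]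
  have hvb' : ∀ ζ ∈ Set.Icc (-1:ℝ) 1, |v' ζ| ≤ 3 * J ζ := by
    intro ζ hζ
    simp only [hv', hJ]
    have h3 : |pdd t ε ζ| ≤ 3 * s ^ 2 := by
      refine (pdd_upper hε hζ).trans ?_
      rw [hN]; gcongr; exact le_max_left _ _
    have h4 : |s ^ 2 - pd t x ε ζ ^ 2| ≤ s ^ 2 + pd t x ε ζ ^ 2 := by
      rw [abs_le]; constructor <;> nlinarith [sq_nonneg s, sq_nonneg (pd t x ε ζ)]
    rw [abs_div, abs_mul, abs_of_pos (pow_pos (hden ζ) 2), ← mul_div_assoc, div_le_div_iff₀ (pow_pos (hden ζ) 2) (hden ζ), pow_two (s ^ 2 + pd t x ε ζ ^ 2), ← mul_assoc]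
    have := (hden ζ).le
    gcongr
  set E : ℝ → ℂ := fun ζ => Complex.exp (Complex.I * (ph t x ε ζ : ℝ)) with hE
  have hEn : ∀ ζ, ‖E ζ‖ = 1 := fun ζ => by
    simp only [hE]; rw [mul_comm]; exact Complex.norm_exp_ofReal_mul_I _
  have hEc : Continuous E := by simp only [hE]; fun_prop
  have hEd : ∀ ζ, HasDerivAt E (E ζ * (Complex.I * (pd t x ε ζ : ℝ))) ζ := fun ζ =>
    ((hasDeriv_ph t x ε ζ).ofReal_comp.const_mul Complex.I).cexp
  have hψc : ContinuousOn ψ (Set.Icc (-1) 1) := fun ζ hζ => (hψ ζ hζ).continuousAt.continuousWithinAt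
  have hd : ∀ ζ ∈ Set.Icc (-1:ℝ) 1, HasDerivAt (fun ζ => E ζ * ψ ζ * (v ζ : ℂ))
      ((E ζ * (Complex.I * (pd t x ε ζ : ℝ)) * ψ ζ + E ζ * ψ' ζ) * (v ζ : ℂ) + E ζ * ψ ζ * (v' ζ : ℂ)) ζ := by
    intro ζ hζ
    exact ((hEd ζ).mul (hψ ζ hζ)).mul (hvd ζ).ofReal_comp
  have hcont1 : ContinuousOn (fun ζ => ((E ζ * (Complex.I * (pd t x ε ζ : ℝ)) * ψ ζ + E ζ * ψ' ζ) * (v ζ : ℂ) + E ζ * ψ ζ * (v' ζ : ℂ))) (Set.Icc (-1) 1) := by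
    have := hEc.continuousOn (s := Set.Icc (-1) 1)
    fun_prop
  have hI := intervalIntegral.integral_eq_sub_of_hasDerivAt (a := -1) (b := 1)
      (fun ζ hζ => hd ζ (huIcc ▸ hζ)) (by rw [← huIcc] at hcont1; exact hcont1.intervalIntegrable)
  have hcR : ContinuousOn (fun ζ => E ζ * (ψ ζ * (J ζ : ℂ) + Complex.I * (ψ' ζ * (v ζ : ℂ) + ψ ζ * (v' ζ : ℂ)))) (Set.Icc (-1) 1) := by
    have := hEc.continuousOn (s := Set.Icc (-1) 1)
    fun_prop
  have hsplit : ∀ ζ, E ζ * ψ ζ = E ζ * (ψ ζ * (J ζ : ℂ) + Complex.I * (ψ' ζ * (v ζ : ℂ) + ψ ζ * (v' ζ : ℂ)))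
      - Complex.I * ((E ζ * (Complex.I * (pd t x ε ζ : ℝ)) * ψ ζ + E ζ * ψ' ζ) * (v ζ : ℂ) + E ζ * ψ ζ * (v' ζ : ℂ)) := by
    intro ζ
    have h1 : (J ζ : ℂ) + (pd t x ε ζ : ℝ) * (v ζ : ℂ) = 1 := by
      norm_cast
      simp only [hJ, hv]
      have := (hden ζ).ne'
      field_simp
    have hI2 : Complex.I * Complex.I = -1 := Complex.I_mul_I
    linear_combination (- E ζ * ψ ζ) * h1 + (E ζ * ψ ζ * (pd t x ε ζ : ℝ) * v ζ) * hI2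
  have hmain : ∫ ζ in (-1:ℝ)..1, E ζ * ψ ζ =
      (∫ ζ in (-1:ℝ)..1, E ζ * (ψ ζ * (J ζ : ℂ) + Complex.I * (ψ' ζ * (v ζ : ℂ) + ψ ζ * (v' ζ : ℂ))))
      - Complex.I * (E 1 * ψ 1 * (v 1 : ℂ) - E (-1) * ψ (-1) * (v (-1) : ℂ)) := by
    rw [← hI, ← intervalIntegral.integral_const_mul, ← intervalIntegral.integral_sub]
    · congr 1; funext ζ; exact hsplit ζ
    · rw [← huIcc] at hcR; exact hcR.intervalIntegrable
    · rw [← huIcc] at hcont1; exact (hcont1.intervalIntegrable).const_mul _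
  have hend : ∀ ζ ∈ Set.Icc (-1:ℝ) 1, ‖E ζ * ψ ζ * (v ζ : ℂ)‖ ≤ M * (1 / s) := by
    intro ζ hζ
    rw [norm_mul, norm_mul, hEn, one_mul, Complex.norm_real, Real.norm_eq_abs]
    exact mul_le_mul (hM ζ hζ) (hvb ζ) (abs_nonneg _) hM0
  have hR : ‖∫ ζ in (-1:ℝ)..1, E ζ * (ψ ζ * (J ζ : ℂ) + Complex.I * (ψ' ζ * (v ζ : ℂ) + ψ ζ * (v' ζ : ℂ)))‖
      ≤ ∫ ζ in (-1:ℝ)..1, (4 * M * J ζ + M * (1 / s)) := by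
    apply intervalIntegral.norm_integral_le_of_norm_le (by norm_num)
    · refine Filter.Eventually.of_forall fun ζ hζ => ?_
      have hζ : ζ ∈ Set.Icc (-1:ℝ) 1 := ⟨hζ.1.le, hζ.2⟩
      rw [norm_mul, hEn, one_mul]
      have a1 : ‖ψ ζ * (J ζ : ℂ)‖ ≤ M * J ζ := by
        rw [norm_mul, Complex.norm_real, Real.norm_of_nonneg (hJ0 ζ)]
        exact mul_le_mul_of_nonneg_right (hM ζ hζ) (hJ0 ζ)
      have a2 : ‖ψ' ζ * (v ζ : ℂ)‖ ≤ M * (1 / s) := by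
        rw [norm_mul, Complex.norm_real, Real.norm_eq_abs]
        exact mul_le_mul (hM' ζ hζ) (hvb ζ) (abs_nonneg _) hM0
      have a3 : ‖ψ ζ * (v' ζ : ℂ)‖ ≤ M * (3 * J ζ) := by
        rw [norm_mul, Complex.norm_real, Real.norm_eq_abs]
        exact mul_le_mul (hM ζ hζ) (hvb' ζ hζ) (abs_nonneg _) hM0
      refine (norm_add_le _ _).trans ?_
      rw [norm_mul Complex.I, Complex.norm_I, one_mul]
      linarith [norm_add_le (ψ' ζ * (v ζ : ℂ)) (ψ ζ * (v' ζ : ℂ))]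
    · exact Continuous.intervalIntegrable (by fun_prop) _ _
  have hJb := Jbound hs hN hε
  have hR2 : ∫ ζ in (-1:ℝ)..1, (4 * M * J ζ + M * (1 / s)) ≤ 66 * M / s := by
    rw [intervalIntegral.integral_add (Continuous.intervalIntegrable (by fun_prop) _ _) (by simp),
      intervalIntegral.integral_const_mul]
    have : 4 * M * ∫ ζ in (-1:ℝ)..1, J ζ ≤ 4 * M * (16 / s) := by gcongr
    refine (add_le_add_left this _).trans (le_of_eq ?_)
    simp
    ring
  rw [hmain]
  refine (norm_sub_le _ _).trans ?_
  rw [norm_mul Complex.I, Complex.norm_I, one_mul]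
  have e1 := hend 1 (by simp)
  have e2 := hend (-1) (by simp)
  have e3 := norm_sub_le (E 1 * ψ 1 * (v 1 : ℂ)) (E (-1) * ψ (-1) * (v (-1) : ℂ))
  have : 68 * M / s = 66 * M / s + (M * (1 / s) + M * (1 / s)) := by ring
  rw [this]
  linarith

/-- The rescaled oscillatory integral. -/
def HH (f : ℝ → ℂ) (ε : ℝ) (p : ℝ × ℝ) : ℂ :=
  ∫ ζ : ℝ, Complex.exp (Complex.I * (ph p.1 p.2 ε ζ : ℝ)) *
    (((|1 + ε * ζ| ^ ((1 : ℝ)/6) : ℝ) : ℂ) * f ζ)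

lemma HH_zero (f : ℝ → ℂ) : HH (FT f) 0 = schrod f := by
  funext p
  unfold HH schrod
  congr 1
  funext ζ
  simp [ph]

lemma FT_eq (φ : SchwartzMap ℝ ℂ) :
    FT φ = fun ξ => (FourierTransform.fourier φ : SchwartzMap ℝ ℂ) ((2 * Real.pi)⁻¹ * ξ) := by
  funext ξ
  rw [SchwartzMap.fourier_coe, Real.fourier_real_eq_integral_exp_smul]
  unfold FT
  congr 1
  funext x
  rw [smul_eq_mul]
  congr 2
  have : (Real.pi : ℂ) ≠ 0 := by exact_mod_cast Real.pi_ne_zero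
  push_cast
  field_simp

lemma FT_contDiff (φ : SchwartzMap ℝ ℂ) : ContDiff ℝ 1 (FT φ) := by
  rw [FT_eq]
  have := (FourierTransform.fourier φ : SchwartzMap ℝ ℂ).smooth 1
  exact this.comp (contDiff_const.mul contDiff_id)

lemma HH_interval (f : ℝ → ℂ) (hf : ∀ ζ : ℝ, ζ ∉ Set.Icc (-1 : ℝ) 1 → f ζ = 0) (ε : ℝ)
    (p : ℝ × ℝ) : HH f ε p = ∫ ζ in (-1:ℝ)..1, Complex.exp (Complex.I * (ph p.1 p.2 ε ζ : ℝ)) *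
    (((|1 + ε * ζ| ^ ((1 : ℝ)/6) : ℝ) : ℂ) * f ζ) := by
  unfold HH
  rw [intervalIntegral.integral_of_le (by norm_num), ← integral_Icc_eq_integral_Ioc]
  rw [setIntegral_eq_integral_of_forall_compl_eq_zero]
  intro ζ hζ
  simp [hf ζ hζ]

lemma weight_bound {ε ζ : ℝ} (hε : |ε| ≤ 1/2) (hζ : ζ ∈ Set.Icc (-1:ℝ) 1) :
    |1 + ε * ζ| ^ ((1 : ℝ)/6) ≤ 2 := by
  have h := abs_le.1 (eps_mul_bound hε hζ)
  rw [abs_of_nonneg (by linarith)]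
  calc (1 + ε * ζ) ^ ((1 : ℝ)/6) ≤ (2:ℝ) ^ ((1 : ℝ)/6) := by
        apply Real.rpow_le_rpow <;> linarith
    _ ≤ 2 ^ (1:ℝ) := Real.rpow_le_rpow_of_exponent_le (by norm_num) (by norm_num)
    _ = 2 := by simp

lemma weight_deriv_bound {ε ζ : ℝ} (hε : |ε| ≤ 1/2) (hζ : ζ ∈ Set.Icc (-1:ℝ) 1) :
    |ε * (1/6) * (1 + ε * ζ) ^ ((1 : ℝ)/6 - 1)| ≤ 1 := by
  have h := abs_le.1 (eps_mul_bound hε hζ)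
  have h2 : (1 + ε * ζ) ^ ((1 : ℝ)/6 - 1) ≤ 2 := by
    calc (1 + ε * ζ) ^ ((1 : ℝ)/6 - 1) ≤ (1/2:ℝ) ^ ((1 : ℝ)/6 - 1) := by
          apply Real.rpow_le_rpow_of_nonpos <;> linarith
      _ ≤ (1/2:ℝ) ^ (-1:ℝ) :=
          Real.rpow_le_rpow_of_exponent_ge (by norm_num) (by norm_num) (by norm_num)
      _ = 2 := by rw [Real.rpow_neg_one]; norm_num
  have h3 : 0 ≤ (1 + ε * ζ) ^ ((1 : ℝ)/6 - 1) := Real.rpow_nonneg (by linarith) _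
  rw [abs_mul, abs_mul, abs_of_nonneg h3, abs_of_nonneg (by norm_num : (0:ℝ) ≤ 1/6)]
  nlinarith [abs_nonneg ε]

lemma HH_decay (f : ℝ → ℂ) (hf : ∀ ζ : ℝ, ζ ∉ Set.Icc (-1 : ℝ) 1 → f ζ = 0)
    (hfc : ContDiff ℝ 1 f) : ∃ C : ℝ, 0 ≤ C ∧ ∀ ε : ℝ, |ε| ≤ 1/2 → ∀ p : ℝ × ℝ,
      ‖HH f ε p‖ ^ 6 ≤ C * (1 + ‖p‖) ^ (-(3:ℝ)) := by
  have hc' : Continuous (deriv f) := hfc.continuous_deriv le_rfl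
  obtain ⟨M0, hM0⟩ := (isCompact_Icc (a := (-1:ℝ)) (b := 1)).exists_bound_of_continuousOn
    hfc.continuous.continuousOn
  obtain ⟨M1, hM1⟩ := (isCompact_Icc (a := (-1:ℝ)) (b := 1)).exists_bound_of_continuousOn
    hc'.continuousOn
  set M := 3 * max M0 M1 with hM
  have hm0 : 0 ≤ M0 := (norm_nonneg _).trans (hM0 0 (by simp))
  have hMM0 : M0 ≤ max M0 M1 := le_max_left _ _
  have hMM1 : M1 ≤ max M0 M1 := le_max_right _ _
  have hMnn : 0 ≤ M := by linarith
  refine ⟨(2 * M) ^ 6 * 8 + (68 * M) ^ 6 * 8, by positivity, fun ε hε p => ?_⟩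
  have hpos : ∀ ζ ∈ Set.Icc (-1:ℝ) 1, 0 < 1 + ε * ζ := fun ζ hζ => by
    have h := abs_le.1 (eps_mul_bound hε hζ)
    linarith
  set ψ : ℝ → ℂ := fun ζ => (((1 + ε * ζ) ^ ((1 : ℝ)/6) : ℝ) : ℂ) * f ζ with hψ
  set ψ' : ℝ → ℂ := fun ζ => ((ε * (1/6) * (1 + ε * ζ) ^ ((1 : ℝ)/6 - 1) : ℝ) : ℂ) * f ζ +
    (((1 + ε * ζ) ^ ((1 : ℝ)/6) : ℝ) : ℂ) * deriv f ζ with hψ'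
  have hH : HH f ε p = ∫ ζ in (-1:ℝ)..1, Complex.exp (Complex.I * (ph p.1 p.2 ε ζ : ℝ)) * ψ ζ := by
    rw [HH_interval f hf]
    apply intervalIntegral.integral_congr
    intro ζ hζ
    rw [Set.uIcc_of_le (by norm_num)] at hζ
    simp only [hψ]
    rw [abs_of_pos (hpos ζ hζ)]
  have hd : ∀ ζ ∈ Set.Icc (-1:ℝ) 1, HasDerivAt ψ (ψ' ζ) ζ := by
    intro ζ hζ
    have h1 : HasDerivAt (fun ζ : ℝ => 1 + ε * ζ) ε ζ := by
      simpa using ((hasDerivAt_id ζ).const_mul ε).const_add 1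
    have h2 := h1.rpow_const (p := (1:ℝ)/6) (Or.inl (hpos ζ hζ).ne')
    have h3 : HasDerivAt f (deriv f ζ) ζ := (hfc.differentiable one_ne_zero ζ).hasDerivAt
    exact h2.ofReal_comp.mul h3
  have hcont : ContinuousOn ψ' (Set.Icc (-1) 1) := by
    have h1 : ∀ r : ℝ, ContinuousOn (fun ζ : ℝ => (1 + ε * ζ) ^ r) (Set.Icc (-1) 1) := fun r =>
      ContinuousOn.rpow_const (by fun_prop) (fun ζ hζ => Or.inl (hpos ζ hζ).ne')
    have h2 := h1 ((1:ℝ)/6)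
    have h3 := h1 ((1:ℝ)/6 - 1)
    have h4 := hfc.continuous
    simp only [hψ']
    fun_prop
  have hw : ∀ ζ ∈ Set.Icc (-1:ℝ) 1, ‖(((1 + ε * ζ) ^ ((1 : ℝ)/6) : ℝ) : ℂ)‖ ≤ 2 := by
    intro ζ hζ
    have := weight_bound hε hζ
    rw [abs_of_pos (hpos ζ hζ)] at this
    rw [Complex.norm_real, Real.norm_of_nonneg (Real.rpow_nonneg (hpos ζ hζ).le _)]
    exact this
  have hb : ∀ ζ ∈ Set.Icc (-1:ℝ) 1, ‖ψ ζ‖ ≤ M := by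
    intro ζ hζ
    simp only [hψ]
    rw [norm_mul]
    have := mul_le_mul (hw ζ hζ) (hM0 ζ hζ) (norm_nonneg _) (by norm_num)
    linarith
  have hb' : ∀ ζ ∈ Set.Icc (-1:ℝ) 1, ‖ψ' ζ‖ ≤ M := by
    intro ζ hζ
    simp only [hψ']
    refine (norm_add_le _ _).trans ?_
    rw [norm_mul, norm_mul]
    have h1 := mul_le_mul (hw ζ hζ) (hM1 ζ hζ) (norm_nonneg _) (by norm_num)
    have h2 := weight_deriv_bound hε hζ
    rw [← Real.norm_eq_abs, ← Complex.norm_real] at h2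
    have h3 := mul_le_mul h2 (hM0 ζ hζ) (norm_nonneg _) (by norm_num)
    linarith
  have hpn : ‖p‖ = max |p.1| |p.2| := by rw [Prod.norm_def]; rfl
  have hrp : (1 + ‖p‖) ^ (-(3:ℝ)) = 1 / (1 + ‖p‖) ^ 3 := by
    rw [Real.rpow_neg (by positivity), one_div]; norm_cast
  rw [hrp, mul_one_div, le_div_iff₀ (by positivity)]
  rcases le_or_gt ‖p‖ 1 with h1 | h1
  · have : ‖HH f ε p‖ ≤ 2 * M := by
      rw [hH]
      have := intervalIntegral.norm_integral_le_of_norm_le_const (a := (-1:ℝ)) (b := 1) (C := M)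
        (f := fun ζ => Complex.exp (Complex.I * (ph p.1 p.2 ε ζ : ℝ)) * ψ ζ) (by
          intro ζ hζ
          rw [Set.uIoc_of_le (by norm_num)] at hζ
          rw [norm_mul, mul_comm Complex.I, Complex.norm_exp_ofReal_mul_I, one_mul]
          exact hb ζ ⟨hζ.1.le, hζ.2⟩)
      refine this.trans (le_of_eq ?_)
      norm_num
      ring
    have h8 : (1 + ‖p‖) ^ 3 ≤ 8 := by
      calc (1 + ‖p‖) ^ 3 ≤ (1 + 1) ^ 3 := by gcongr
        _ = 8 := by norm_num
    calc _ ≤ (2 * M) ^ 6 * 8 := by gcongr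
      _ ≤ _ := le_add_of_nonneg_right (by positivity)
  · have hs : 0 < √‖p‖ := Real.sqrt_pos.2 (by linarith)
    have hs2 : √‖p‖ ^ 2 = ‖p‖ := Real.sq_sqrt (by linarith)
    have := osc hs (hs2.trans hpn) hε ψ ψ' hd hcont hb hb'
    rw [← hH] at this
    have h8 : (1 + ‖p‖) ^ 3 ≤ 8 * ‖p‖ ^ 3 := by
      calc (1 + ‖p‖) ^ 3 ≤ (‖p‖ + ‖p‖) ^ 3 := by gcongr
        _ = _ := by ring
    calc _ ≤ (68 * M / √‖p‖) ^ 6 * (8 * ‖p‖ ^ 3) := by gcongr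
      _ = (68 * M) ^ 6 * 8 := by
        rw [div_pow, show √‖p‖ ^ 6 = (√‖p‖ ^ 2) ^ 3 by ring, hs2]
        field_simp
      _ ≤ _ := le_add_of_nonneg_left (by positivity)

lemma HH_cont (f : ℝ → ℂ) (hf : ∀ ζ : ℝ, ζ ∉ Set.Icc (-1 : ℝ) 1 → f ζ = 0)
    (hfc : Continuous f) (ε : ℝ) : Continuous (HH f ε) := by
  have : HH f ε = fun p => ∫ ζ in (-1:ℝ)..1, Complex.exp (Complex.I * (ph p.1 p.2 ε ζ : ℝ)) *
    (((|1 + ε * ζ| ^ ((1 : ℝ)/6) : ℝ) : ℂ) * f ζ) := funext (HH_interval f hf ε)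
  rw [this]
  apply intervalIntegral.continuous_parametric_intervalIntegral_of_continuous'
  unfold ph
  have h1 : Continuous (fun y : ℝ => |y| ^ ((1:ℝ)/6)) :=
    continuous_abs.rpow_const (fun _ => Or.inr (by norm_num))
  have h2 : Continuous (fun q : (ℝ × ℝ) × ℝ => |1 + ε * q.2| ^ ((1:ℝ)/6)) :=
    h1.comp (by fun_prop)
  simp only [Function.uncurry_def]
  fun_prop

lemma HH_tendsto (f : ℝ → ℂ) (hf : ∀ ζ : ℝ, ζ ∉ Set.Icc (-1 : ℝ) 1 → f ζ = 0)
    (hfc : Continuous f) (p : ℝ × ℝ) : Tendsto (fun ε => HH f ε p) (𝓝 0) (𝓝 (HH f 0 p)) := by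
  have : (fun ε => HH f ε p) = fun ε => ∫ ζ in (-1:ℝ)..1, Complex.exp (Complex.I * (ph p.1 p.2 ε ζ : ℝ)) *
    (((|1 + ε * ζ| ^ ((1 : ℝ)/6) : ℝ) : ℂ) * f ζ) := funext fun ε => HH_interval f hf ε p
  have hc : Continuous (fun ε => HH f ε p) := by
    rw [this]
    apply intervalIntegral.continuous_parametric_intervalIntegral_of_continuous'
    unfold ph
    have h1 : Continuous (fun y : ℝ => |y| ^ ((1:ℝ)/6)) :=
      continuous_abs.rpow_const (fun _ => Or.inr (by norm_num))
    have h2 : Continuous (fun q : ℝ × ℝ => |1 + q.1 * q.2| ^ ((1:ℝ)/6)) :=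
      h1.comp (by fun_prop)
    simp only [Function.uncurry_def]
    fun_prop
  exact hc.tendsto 0

lemma HH_lintegral_tendsto (f : ℝ → ℂ) (hf : ∀ ζ : ℝ, ζ ∉ Set.Icc (-1 : ℝ) 1 → f ζ = 0)
    (hfc : ContDiff ℝ 1 f) : Tendsto (fun ε => ∫⁻ p : ℝ × ℝ, ‖HH f ε p‖ₑ ^ (6:ℝ)) (𝓝 0)
      (𝓝 (∫⁻ p : ℝ × ℝ, ‖HH f 0 p‖ₑ ^ (6:ℝ))) := by
  obtain ⟨C, hC, hb⟩ := HH_decay f hf hfc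
  have hint : Integrable (fun p : ℝ × ℝ => C * (1 + ‖p‖) ^ (-(3:ℝ))) :=
    (integrable_one_add_norm (by simp; norm_num)).const_mul C
  apply tendsto_lintegral_filter_of_dominated_convergence
    (fun p => ENNReal.ofReal (C * (1 + ‖p‖) ^ (-(3:ℝ))))
  · refine Eventually.of_forall fun ε => ?_
    have := (HH_cont f hf hfc.continuous ε).enorm.measurable
    fun_prop
  · have : ∀ᶠ ε : ℝ in 𝓝 0, |ε| ≤ 1/2 := by
      have := Metric.closedBall_mem_nhds (0:ℝ) (by norm_num : (0:ℝ) < 1/2)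
      filter_upwards [this] with ε hε
      simpa using hε
    filter_upwards [this] with ε hε
    refine Eventually.of_forall fun p => ?_
    have h6 : ‖HH f ε p‖ₑ ^ (6:ℝ) = ENNReal.ofReal (‖HH f ε p‖ ^ 6) := by
      rw [ENNReal.ofReal_pow (norm_nonneg _), ofReal_norm]; norm_cast
    rw [h6]
    exact ENNReal.ofReal_le_ofReal (hb ε hε p)
  · exact hint.lintegral_lt_top.ne
  · refine Eventually.of_forall fun p => ?_
    exact ((HH_tendsto f hf hfc.continuous p).enorm).ennrpow_const 6

lemma FT_gT (φ : ℝ → ℂ) (x₀ h a η : ℝ) (hh : 0 < h) :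
    FT (gT x₀ h (modF a φ)) η =
      ((h ^ ((1:ℝ)/2) : ℝ) : ℂ) * Complex.exp (-(Complex.I * x₀ * η)) * FT φ (h * η - a) := by
  have hhc : (h : ℂ) ≠ 0 := by exact_mod_cast hh.ne'
  set G : ℝ → ℂ := fun z => Complex.exp (-(Complex.I * (h * z + x₀) * η)) *
    (((h ^ (-(1 : ℝ)/2) : ℝ) : ℂ) * (Complex.exp (Complex.I * z * a) * φ z)) with hG
  have h1 : FT (gT x₀ h (modF a φ)) η = ∫ y : ℝ, G ((y - x₀) / h) := by
    unfold FT gT modF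
    congr 1
    funext y
    simp only [hG]
    congr 3
    push_cast
    field_simp
    ring
  rw [h1, integral_sub_right_eq_self (fun y => G (y / h)) x₀, Measure.integral_comp_div G h,
    abs_of_pos hh]
  have hpow : h * h ^ (-(1:ℝ)/2) = h ^ ((1:ℝ)/2) := by
    conv_lhs => rw [← Real.rpow_one h, ← Real.rpow_mul hh.le, ← Real.rpow_add hh]
    norm_num
  unfold FT
  rw [← integral_const_mul, real_smul, ← integral_const_mul]
  congr 1
  funext z
  simp only [hG]
  rw [← hpow]
  have e : Complex.exp (-(Complex.I * (h * z + x₀) * η)) * Complex.exp (Complex.I * z * a) =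
      Complex.exp (-(Complex.I * x₀ * η)) * Complex.exp (-(Complex.I * z * ((h * η - a : ℝ) : ℂ))) := by
    rw [← Complex.exp_add, ← Complex.exp_add]
    congr 1
    push_cast
    ring
  rw [ofReal_mul]
  linear_combination (h * ((h ^ (-(1 : ℝ)/2) : ℝ) : ℂ) * φ z) * e

lemma norm_airy (φ : ℝ → ℂ) (t₀ x₀ h a : ℝ) (hh : 0 < h) (ha : a ≠ 0) (p : ℝ × ℝ) :
    ‖airyD6shift t₀ (gT x₀ h (modF a φ)) p‖ = h ^ (-(2:ℝ)/3) * |a| ^ ((1:ℝ)/6) *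
      ‖HH (FT φ) a⁻¹ (3 * a / h ^ 3 * (p.1 - t₀),
        3 * a ^ 2 / h ^ 3 * (p.1 - t₀) + 1 / h * (p.2 - x₀))‖ := by
  have hhc : (h : ℂ) ≠ 0 := by exact_mod_cast hh.ne'
  have hac : (a : ℂ) ≠ 0 := by exact_mod_cast ha
  set q : ℝ × ℝ := (3 * a / h ^ 3 * (p.1 - t₀),
        3 * a ^ 2 / h ^ 3 * (p.1 - t₀) + 1 / h * (p.2 - x₀)) with hq
  set θ : ℝ := (p.2 - x₀) * a / h + (p.1 - t₀) * a ^ 3 / h ^ 3 with hθ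
  set c : ℝ := h ^ ((1:ℝ)/2) * (|a| / h) ^ ((1:ℝ)/6) with hc
  set G : ℝ → ℂ := fun ζ => ((c : ℂ) * Complex.exp (θ * Complex.I)) *
    (Complex.exp (Complex.I * (ph q.1 q.2 a⁻¹ ζ : ℝ)) *
    (((|1 + a⁻¹ * ζ| ^ ((1 : ℝ)/6) : ℝ) : ℂ) * FT φ ζ)) with hG
  have h1 : airyD6shift t₀ (gT x₀ h (modF a φ)) p = ∫ η : ℝ, G (h * η - a) := by
    unfold airyD6shift
    congr 1
    funext η
    rw [FT_gT φ x₀ h a η hh]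
    simp only [hG]
    have e : Complex.exp (θ * Complex.I) * Complex.exp (Complex.I * (ph q.1 q.2 a⁻¹ (h * η - a) : ℝ)) =
        Complex.exp (Complex.I * (p.2 * η + (p.1 - t₀) * η ^ 3)) * Complex.exp (-(Complex.I * x₀ * η)) := by
      rw [← Complex.exp_add, ← Complex.exp_add]
      congr 1
      simp only [hq, hθ, ph]
      push_cast
      field_simp
      ring
    have w : |η| ^ ((1:ℝ)/6) = (|a| / h) ^ ((1:ℝ)/6) * |1 + a⁻¹ * (h * η - a)| ^ ((1:ℝ)/6) := by
      rw [← Real.mul_rpow (by positivity) (abs_nonneg _)]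
      congr 1
      rw [show 1 + a⁻¹ * (h * η - a) = a⁻¹ * h * η by field_simp; ring, abs_mul, abs_mul, abs_inv,
        abs_of_pos hh]
      have := abs_ne_zero.2 ha
      field_simp
    rw [w, hc]
    push_cast
    linear_combination (-(((h ^ ((1:ℝ)/2) : ℝ) : ℂ) * (((|a| / h) ^ ((1:ℝ)/6) : ℝ) : ℂ) * ((|1 + a⁻¹ * (h * η - a)| ^ ((1:ℝ)/6) : ℝ) : ℂ) * FT φ (h * η - a))) * e
  have h2 : ∫ η : ℝ, G (h * η - a) = (h⁻¹ : ℝ) • ∫ ζ, G ζ := by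
    rw [Measure.integral_comp_mul_left (fun y => G (y - a)) h, integral_sub_right_eq_self,
      abs_of_pos (inv_pos.2 hh)]
  have h3 : ∫ ζ, G ζ = ((c : ℂ) * Complex.exp (θ * Complex.I)) * HH (FT φ) a⁻¹ q := by
    unfold HH
    rw [← integral_const_mul]
  have hc0 : 0 ≤ c := by positivity
  rw [h1, h2, h3, norm_smul, norm_mul, norm_mul, Complex.norm_exp_ofReal_mul_I, mul_one,
    Complex.norm_real, Real.norm_of_nonneg hc0, Real.norm_of_nonneg (inv_pos.2 hh).le, ← mul_assoc]
  congr 1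
  rw [hc, Real.div_rpow (abs_nonneg _) hh.le, ← Real.rpow_neg_one, div_eq_mul_inv (|a| ^ ((1:ℝ)/6)), ← Real.rpow_neg hh.le]
  have : h ^ (-(2:ℝ)/3) = h ^ (-1:ℝ) * h ^ ((1:ℝ)/2) * h ^ (-((1:ℝ)/6)) := by
    rw [← Real.rpow_add hh, ← Real.rpow_add hh]; norm_num
  rw [this]
  ring

lemma lintegral_affine (F : ℝ × ℝ → ENNReal) (hF : Measurable F) (α β γ t₀ x₀ : ℝ)
    (hα : α ≠ 0) (hγ : γ ≠ 0) :
    ∫⁻ p : ℝ × ℝ, F (α * (p.1 - t₀), β * (p.1 - t₀) + γ * (p.2 - x₀)) =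
      ENNReal.ofReal |(α * γ)⁻¹| * ∫⁻ p, F p := by
  set L : ℝ × ℝ →ₗ[ℝ] ℝ × ℝ := Matrix.toLin (Module.Basis.finTwoProd ℝ) (Module.Basis.finTwoProd ℝ)
    !![α, 0; β, γ] with hL
  have hdet : LinearMap.det L = α * γ := by
    rw [hL, LinearMap.det_toLin, Matrix.det_fin_two_of]; ring
  have hLap : ∀ p, L p = (α * p.1, β * p.1 + γ * p.2) := by
    intro p
    rw [hL, Matrix.toLin_finTwoProd_apply]; simp
  have hLm : Measurable L := L.continuous_of_finiteDimensional.measurable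
  have h1 := lintegral_sub_right_eq_self (μ := (volume : Measure (ℝ × ℝ))) (fun p => F (L p)) (t₀, x₀)
  have h2 : ∫⁻ p, F (L p) = ∫⁻ p, F p ∂(Measure.map L volume) := (lintegral_map hF hLm).symm
  rw [Measure.map_linearMap_addHaar_eq_smul_addHaar volume (by rw [hdet]; exact mul_ne_zero hα hγ),
    lintegral_smul_measure, hdet] at h2
  rw [smul_eq_mul] at h2
  rw [← h2, ← h1]
  congr 1
  funext p
  rw [hLap]
  rfl

lemma lintegral_airy (φ : ℝ → ℂ) (hc : ∀ ε, Continuous (HH (FT φ) ε))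
    (t₀ x₀ h a : ℝ) (hh : 0 < h) (ha : a ≠ 0) :
    ∫⁻ p : ℝ × ℝ, ‖airyD6shift t₀ (gT x₀ h (modF a φ)) p‖ₑ ^ (6:ℝ) =
      ENNReal.ofReal (1/3) * ∫⁻ p : ℝ × ℝ, ‖HH (FT φ) a⁻¹ p‖ₑ ^ (6:ℝ) := by
  set c := h ^ (-(2:ℝ)/3) * |a| ^ ((1:ℝ)/6) with hcc
  have hc0 : 0 ≤ c := by positivity
  set F : ℝ × ℝ → ENNReal := fun p => ‖HH (FT φ) a⁻¹ p‖ₑ ^ (6:ℝ) with hF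
  have hFm : Measurable F := by
    have := (hc a⁻¹).enorm.measurable
    fun_prop
  have key : ∀ p, ‖airyD6shift t₀ (gT x₀ h (modF a φ)) p‖ₑ ^ (6:ℝ) = ENNReal.ofReal c ^ (6:ℝ) *
      F (3 * a / h ^ 3 * (p.1 - t₀), 3 * a ^ 2 / h ^ 3 * (p.1 - t₀) + 1 / h * (p.2 - x₀)) := by
    intro p
    rw [← ofReal_norm, norm_airy φ t₀ x₀ h a hh ha p, ENNReal.ofReal_mul hc0, ofReal_norm,
      ENNReal.mul_rpow_of_nonneg _ _ (by norm_num)]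
  have hα : 3 * a / h ^ 3 ≠ 0 := by positivity
  have hγ : 1 / h ≠ 0 := by positivity
  simp_rw [key]
  rw [lintegral_const_mul _ (by fun_prop), lintegral_affine F hFm _ _ _ _ _ hα hγ, ← mul_assoc]
  congr 1
  rw [ENNReal.ofReal_rpow_of_nonneg hc0 (by norm_num), ← ENNReal.ofReal_mul (by positivity)]
  congr 1
  rw [hcc, Real.mul_rpow (by positivity) (by positivity), ← Real.rpow_mul hh.le,
    ← Real.rpow_mul (abs_nonneg _)]
  have e1 : h ^ (-(2:ℝ)/3 * 6) = (h ^ 4)⁻¹ := by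
    rw [show -(2:ℝ)/3 * 6 = -((4:ℕ):ℝ) by norm_num, Real.rpow_neg hh.le, Real.rpow_natCast]
  have e2 : |a| ^ ((1:ℝ)/6 * 6) = |a| := by norm_num
  rw [e1, e2]
  have e3 : |(3 * a / h ^ 3 * (1 / h))⁻¹| = h ^ 4 / (3 * |a|) := by
    rw [show (3 * a / h ^ 3 * (1 / h))⁻¹ = h ^ 4 / (3 * a) by field_simp, abs_div, abs_mul,
      abs_of_pos (pow_pos hh 4)]
    norm_num
  rw [e3]
  have := abs_ne_zero.2 ha
  field_simp

/-- Asymptotic Schrödinger behavior of Airy profiles with escaping frequency. -/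
theorem asymptotic_schrodinger_behavior (φ : SchwartzMap ℝ ℂ)
    (hsupp : ∀ ζ : ℝ, ζ ∉ Set.Icc (-1 : ℝ) 1 → FT (⇑φ) ζ = 0)
    (h ξ x t : ℕ → ℝ) (hh : ∀ n, 0 < h n)
    (hfreq : Tendsto (fun n => |h n * ξ n|) atTop atTop) :
    Tendsto (fun n => eLpNorm
        (airyD6shift (t n) (gT (x n) (h n) (modF (h n * ξ n) (⇑φ))))
        6 (volume : Measure (ℝ × ℝ)))
      atTop
      (𝓝 (ENNReal.ofReal ((3 : ℝ) ^ (-(1 : ℝ)/6)) *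
        eLpNorm (schrod (⇑φ)) 6 (volume : Measure (ℝ × ℝ)))) := by
  have hfc := FT_contDiff φ
  have hcont := HH_cont (FT φ) hsupp hfc.continuous
  have hform : ∀ F : ℝ × ℝ → ℂ, eLpNorm F 6 (volume : Measure (ℝ × ℝ)) =
      (∫⁻ p, ‖F p‖ₑ ^ (6:ℝ)) ^ ((1:ℝ)/6) := by
    intro F
    rw [eLpNorm_eq_lintegral_rpow_enorm_toReal (by norm_num) (by norm_num)]
    norm_num
  have hlim : Tendsto (fun n => (h n * ξ n)⁻¹) atTop (𝓝 0) := by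
    rw [tendsto_zero_iff_abs_tendsto_zero]
    have := tendsto_inv_atTop_zero.comp hfreq
    refine this.congr fun n => ?_
    simp [abs_inv, Function.comp]
  have h1 := (HH_lintegral_tendsto (FT φ) hsupp hfc).comp hlim
  have h2 := (ENNReal.Tendsto.const_mul (a := ENNReal.ofReal (1/3)) h1
    (Or.inr ENNReal.ofReal_ne_top)).ennrpow_const ((1:ℝ)/6)
  have hR : ENNReal.ofReal ((3 : ℝ) ^ (-(1 : ℝ)/6)) *
        eLpNorm (schrod (⇑φ)) 6 (volume : Measure (ℝ × ℝ)) =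
      (ENNReal.ofReal (1/3) * ∫⁻ p : ℝ × ℝ, ‖HH (FT φ) 0 p‖ₑ ^ (6:ℝ)) ^ ((1:ℝ)/6) := by
    rw [hform, HH_zero, ENNReal.mul_rpow_of_nonneg _ _ (by norm_num),
      ENNReal.ofReal_rpow_of_nonneg (by norm_num) (by norm_num)]
    congr 2
    rw [one_div, Real.inv_rpow (by norm_num), ← Real.rpow_neg (by norm_num)]
    norm_num
  rw [hR]
  refine h2.congr' ?_
  filter_upwards [hfreq.eventually_gt_atTop 0] with n hn
  rw [hform, lintegral_airy φ hcont (t n) (x n) (h n) (h n * ξ n) (hh n) (abs_pos.1 hn)]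
  rfl

end
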